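/- Let ρ be a separable two-qubit density matrix. Then its second moment of random correlations satisfies R^(2)(ρ) := ∬_{S²×S²} (Tr[ρ (σ_u ⊗ σ_w)])² dμ(u) dμ(w) ≤ 1/9. -/

import Mathlib

open MeasureTheory Matrix Kronecker
open scoped ComplexOrder

noncomputable section

abbrev E3 : Type := EuclideanSpace ℝ (Fin 3)

/-- The unit sphere `S²` in `ℝ³`. -/
abbrev S2 : Type := Metric.sphere (0 : E3) 1

/-- The action of a linear isometry (rotation) of `ℝ³` on the unit sphere. -/
def sphereMap (f : E3 ≃ₗᵢ[ℝ] E3) (x : S2) : S2 :=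
  ⟨f x, by
    have h : ‖(x : E3)‖ = 1 := by simpa using mem_sphere_zero_iff_norm.mp x.2
    simp [mem_sphere_zero_iff_norm, h]⟩

/-- The three Pauli matrices `σ_x, σ_y, σ_z`. -/
def pauli : Fin 3 → Matrix (Fin 2) (Fin 2) ℂ
  | 0 => !![0, 1; 1, 0]
  | 1 => !![0, -Complex.I; Complex.I, 0]
  | 2 => !![1, 0; 0, -1]

/-- For a direction `u ∈ ℝ³`, the operator `σ_u = u₁σ₁ + u₂σ₂ + u₃σ₃`. -/
def pauliVec (u : Fin 3 → ℝ) : Matrix (Fin 2) (Fin 2) ℂ :=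
  ∑ j, (u j : ℂ) • pauli j

/-- The coordinates of a point of the unit sphere `S²`. -/
def coords (x : S2) : Fin 3 → ℝ := fun j => (x : E3) j

/-- A two-qubit density matrix `ρ` is separable if it is a finite convex combination of
Kronecker products of single-qubit density matrices. -/
def IsSeparableTwoQubit (ρ : Matrix (Fin 2 × Fin 2) (Fin 2 × Fin 2) ℂ) : Prop :=
  ∃ (n : ℕ) (p : Fin n → ℝ) (A B : Fin n → Matrix (Fin 2) (Fin 2) ℂ),
    (∀ k, 0 ≤ p k) ∧ (∑ k, p k = 1) ∧
    (∀ k, (A k).PosSemidef) ∧ (∀ k, (A k).trace = 1) ∧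
    (∀ k, (B k).PosSemidef) ∧ (∀ k, (B k).trace = 1) ∧
    ρ = ∑ k, (p k : ℂ) • (A k ⊗ₖ B k)

/-- Every single-qubit density matrix has a Bloch vector, which lies in the unit ball. -/
theorem exists_blochVector {A : Matrix (Fin 2) (Fin 2) ℂ} (hA : A.PosSemidef)
    (htr : A.trace = 1) :
    ∃ a : Fin 3 → ℝ, ∑ j, a j ^ 2 ≤ 1 ∧
      ∀ u, (A * pauliVec u).trace = ((∑ j, a j * u j : ℝ) : ℂ) := by
  have h00 := Complex.ext_iff.mp (hA.isHermitian.apply 0 0)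
  have h11 := Complex.ext_iff.mp (hA.isHermitian.apply 1 1)
  have h10 := Complex.ext_iff.mp (hA.isHermitian.apply 1 0)
  have hdet := (Complex.le_def.mp hA.det_nonneg).1
  have htr' := (Complex.ext_iff.mp htr).1
  simp [Matrix.det_fin_two, Matrix.trace_fin_two] at h00 h11 h10 hdet htr'
  have i00 : (A 0 0).im = 0 := by linarith
  have i11 : (A 1 1).im = 0 := by linarith
  refine ⟨![2 * (A 0 1).re, -2 * (A 0 1).im, (A 0 0).re - (A 1 1).re], ?_, fun u => ?_⟩
  · rw [← h10.1, ← h10.2, i00, i11] at hdet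
    rw [Fin.sum_univ_three]
    change (2 * (A 0 1).re) ^ 2 + (-2 * (A 0 1).im) ^ 2 + ((A 0 0).re - (A 1 1).re) ^ 2 ≤ 1
    have hsq : ((A 0 0).re + (A 1 1).re) ^ 2 = 1 := by rw [htr', one_pow]
    nlinarith
  · apply Complex.ext
    · simp [pauliVec, pauli, Fin.sum_univ_three, Matrix.trace_fin_two, Matrix.mul_apply]
      linear_combination (- u 0) * h10.1 - u 1 * h10.2
    · simp [pauliVec, pauli, Fin.sum_univ_three, Matrix.trace_fin_two, Matrix.mul_apply]
      linear_combination (- u 0) * h10.2 + u 1 * h10.1 + u 2 * i00 - u 2 * i11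

theorem continuous_coords (i : Fin 3) : Continuous fun x : S2 => coords x i := by
  unfold coords
  fun_prop

theorem sum_coords_sq (x : S2) : ∑ i, coords x i ^ 2 = 1 := by
  have h : ‖(x : E3)‖ = 1 := mem_sphere_zero_iff_norm.mp x.2
  have h' := EuclideanSpace.real_norm_sq_eq (x : E3)
  rw [h, one_pow] at h'
  exact h'.symm

theorem continuous_sphereMap (f : E3 ≃ₗᵢ[ℝ] E3) : Continuous (sphereMap f) := by
  unfold sphereMap
  fun_prop

theorem integrable_of_continuous_of_compact {X : Type*} [TopologicalSpace X] [CompactSpace X]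
    [MeasurableSpace X] [OpensMeasurableSpace X] {μ : Measure X} [IsFiniteMeasure μ] {g : X → ℝ}
    (hg : Continuous g) : Integrable g μ :=
  integrableOn_univ.mp <| hg.continuousOn.integrableOn_compact' isCompact_univ MeasurableSet.univ

section Invariant

variable {μ : Measure S2}

theorem integral_comp_sphereMap (hinv : ∀ f : E3 ≃ₗᵢ[ℝ] E3, μ.map (sphereMap f) = μ)
    (f : E3 ≃ₗᵢ[ℝ] E3) {g : S2 → ℝ} (hg : Continuous g) :
    ∫ x, g (sphereMap f x) ∂μ = ∫ x, g x ∂μ := by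
  conv_rhs => rw [← hinv f]
  exact (integral_map (continuous_sphereMap f).aemeasurable hg.aestronglyMeasurable).symm

theorem integral_coords_mul_coords_of_ne
    (hinv : ∀ f : E3 ≃ₗᵢ[ℝ] E3, μ.map (sphereMap f) = μ) {i j : Fin 3} (hij : i ≠ j) :
    ∫ x, coords x i * coords x j ∂μ = 0 := by
  let f : E3 ≃ₗᵢ[ℝ] E3 := LinearIsometryEquiv.piLpCongrRight 2 fun k =>
    if k = i then LinearIsometryEquiv.neg ℝ else LinearIsometryEquiv.refl ℝ ℝ
  have h := integral_comp_sphereMap hinv f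
    (g := fun x => coords x i * coords x j)
    ((continuous_coords i).mul (continuous_coords j))
  have hf : ∀ x, coords (sphereMap f x) i * coords (sphereMap f x) j
      = -(coords x i * coords x j) := by
    intro x
    simp [f, coords, sphereMap, hij.symm]
  simp only [hf, integral_neg] at h
  linarith

theorem integral_coords_sq_eq (hinv : ∀ f : E3 ≃ₗᵢ[ℝ] E3, μ.map (sphereMap f) = μ)
    (i j : Fin 3) :
    ∫ x, coords x i ^ 2 ∂μ = ∫ x, coords x j ^ 2 ∂μ := by
  have h := integral_comp_sphereMap hinv
    (LinearIsometryEquiv.piLpCongrLeft 2 ℝ ℝ (Equiv.swap i j))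
    (g := fun x => coords x i ^ 2) ((continuous_coords i).pow 2)
  rw [← h]
  simp [coords, sphereMap, LinearIsometryEquiv.piLpCongrLeft_apply, Equiv.piCongrLeft']

variable [IsProbabilityMeasure μ]

theorem integral_coords_sq (hinv : ∀ f : E3 ≃ₗᵢ[ℝ] E3, μ.map (sphereMap f) = μ)
    (i : Fin 3) : ∫ x, coords x i ^ 2 ∂μ = 1 / 3 := by
  have h : ∫ x, ∑ j, coords x j ^ 2 ∂μ = 1 := by simp [sum_coords_sq]
  rw [integral_finsetSum _ fun j _ =>
      integrable_of_continuous_of_compact (g := fun x => coords x j ^ 2)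
        ((continuous_coords j).pow 2),
    Finset.sum_congr rfl fun j _ => integral_coords_sq_eq hinv j i] at h
  simp at h
  linarith

/-- The second moment of a linear functional on the sphere. -/
theorem integral_sum_mul_coords_sq (hinv : ∀ f : E3 ≃ₗᵢ[ℝ] E3, μ.map (sphereMap f) = μ)
    (a : Fin 3 → ℝ) :
    ∫ x, (∑ j, a j * coords x j) ^ 2 ∂μ = (∑ j, a j ^ 2) / 3 := by
  have hint : ∀ i j, Integrable (fun x => a i * a j * (coords x i * coords x j)) μ := fun i j =>
    integrable_of_continuous_of_compact
      (continuous_const.mul ((continuous_coords i).mul (continuous_coords j)))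
  have hexp : ∀ x, (∑ j, a j * coords x j) ^ 2
      = ∑ i, ∑ j, a i * a j * (coords x i * coords x j) := by
    intro x
    rw [sq, Finset.sum_mul_sum]
    exact Finset.sum_congr rfl fun i _ => Finset.sum_congr rfl fun j _ => by ring
  have hmoment : ∀ i j, ∫ x, coords x i * coords x j ∂μ = if i = j then 1 / 3 else 0 := by
    intro i j
    split_ifs with hij
    · subst hij
      simpa only [sq] using integral_coords_sq hinv i
    · exact integral_coords_mul_coords_of_ne hinv hij
  simp_rw [hexp]
  rw [integral_finsetSum _ fun i _ => integrable_finsetSum _ fun j _ => hint i j]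
  simp_rw [integral_finsetSum _ fun j _ => hint _ j, integral_const_mul, hmoment]
  simp [Finset.sum_mul, sq, div_eq_mul_inv]

end Invariant

/-- for every separable two-qubit density matrix `ρ`, the second moment of
random correlations satisfies
`R^(2)(ρ) = ∬_{S²×S²} (Tr[ρ (σ_u ⊗ σ_w)])² dμ(u)dμ(w) ≤ 1/9`,
where `μ` is the rotation-invariant (uniform) probability measure on `S²`. -/
theorem second_moment_le_of_separable
    (ρ : Matrix (Fin 2 × Fin 2) (Fin 2 × Fin 2) ℂ) (hsep : IsSeparableTwoQubit ρ)
    (μ : Measure S2) [IsProbabilityMeasure μ]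
    (hinv : ∀ f : E3 ≃ₗᵢ[ℝ] E3, μ.map (sphereMap f) = μ) :
    (∫ p : S2 × S2,
        ((ρ * (pauliVec (coords p.1) ⊗ₖ pauliVec (coords p.2))).trace).re ^ 2
        ∂(μ.prod μ)) ≤ 1 / 9 := by
  obtain ⟨n, p, A, B, hp, hp1, hA, hAtr, hB, hBtr, rfl⟩ := hsep
  choose a ha hau using fun k => exists_blochVector (hA k) (hAtr k)
  choose b hb hbw using fun k => exists_blochVector (hB k) (hBtr k)
  have htrace : ∀ u w, (((∑ k, (p k : ℂ) • (A k ⊗ₖ B k)) *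
      (pauliVec u ⊗ₖ pauliVec w)).trace).re
      = ∑ k, p k * ((∑ j, a k j * u j) * ∑ j, b k j * w j) := by
    intro u w
    simp_rw [Finset.sum_mul, Matrix.trace_sum, smul_mul_assoc, ← Matrix.mul_kronecker_mul,
      Matrix.trace_smul, Matrix.trace_kronecker, hau, hbw, smul_eq_mul, ← Complex.ofReal_mul,
      ← Complex.ofReal_sum, Complex.ofReal_re]
    simp_rw [Finset.sum_mul]
  simp_rw [htrace]
  have hcont : ∀ c : Fin 3 → ℝ, Continuous fun x : S2 => ∑ j, c j * coords x j := fun c =>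
    continuous_finsetSum _ fun j _ => continuous_const.mul (continuous_coords j)
  have hcontA : ∀ k, Continuous fun q : S2 × S2 => ∑ j, a k j * coords q.1 j := fun k =>
    (hcont (a k)).comp continuous_fst
  have hcontB : ∀ k, Continuous fun q : S2 × S2 => ∑ j, b k j * coords q.2 j := fun k =>
    (hcont (b k)).comp continuous_snd
  have hint : ∀ k, Integrable (fun q : S2 × S2 => p k *
      ((∑ j, a k j * coords q.1 j) ^ 2 * (∑ j, b k j * coords q.2 j) ^ 2)) (μ.prod μ) := fun k =>
    integrable_of_continuous_of_compact
      (continuous_const.mul (((hcontA k).pow 2).mul ((hcontB k).pow 2)))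
  calc
    _ ≤ ∫ q : S2 × S2, ∑ k, p k *
        ((∑ j, a k j * coords q.1 j) ^ 2 * (∑ j, b k j * coords q.2 j) ^ 2) ∂(μ.prod μ) := by
      refine integral_mono (integrable_of_continuous_of_compact
        ((continuous_finsetSum _ fun k _ =>
          continuous_const.mul ((hcontA k).mul (hcontB k))).pow 2))
        (integrable_finsetSum _ fun k _ => hint k) fun q => ?_
      simpa only [mul_pow] using
        Real.pow_arith_mean_le_arith_mean_pow_of_even Finset.univ p
          (fun k => (∑ j, a k j * coords q.1 j) * ∑ j, b k j * coords q.2 j)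
          (fun k _ => hp k) hp1 even_two
    _ = ∑ k, p k * ((∑ j, a k j ^ 2) / 3 * ((∑ j, b k j ^ 2) / 3)) := by
      rw [integral_finsetSum _ fun k _ => hint k]
      refine Finset.sum_congr rfl fun k _ => ?_
      rw [integral_const_mul, integral_prod_mul (fun x => (∑ j, a k j * coords x j) ^ 2)
        (fun x => (∑ j, b k j * coords x j) ^ 2), integral_sum_mul_coords_sq hinv,
        integral_sum_mul_coords_sq hinv]
    _ ≤ ∑ k, p k * (1 / 3 * (1 / 3)) := by
      gcongr with k
      · exact hp k
      · exact ha k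
      · exact hb k
    _ = 1 / 9 := by
      rw [← Finset.sum_mul, hp1]
      norm_num
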